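/- Let w be of minimal length in its conjugacy class in W and let v ∈ W satisfy ℓ(v⁻¹wv) = ℓ(w). Writing v = u·x with u ∈ W_{J(w)} and x ∈ X_{J(w)}, one has J(v⁻¹wv) = x⁻¹ J(w) x. -/

import Mathlib

/-- The set `J(w)` of simple reflections occurring in a reduced expression for `w`. -/
def coxSupport {B W : Type*} [Group W] {M : CoxeterMatrix B}
    (cs : CoxeterSystem M W) (w : W) : Set B :=
  {b : B | ∃ ω : List B, cs.IsReduced ω ∧ cs.wordProd ω = w ∧ b ∈ ω}

namespace CoxeterSystem

variable {B W : Type*} [Group W] {M : CoxeterMatrix B} (cs : CoxeterSystem M W)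

open Classical in
/-- The action of a simple reflection on `W × ZMod 2`: conjugation on the first factor, recording
in the second factor whether the argument is the reflection itself. -/
noncomputable def signedConj (i : B) : Function.End (W × ZMod 2) :=
  fun p => (cs.simple i * p.1 * cs.simple i, p.2 + if p.1 = cs.simple i then 1 else 0)

open Classical in
theorem signedConj_mul_pow_apply (i j : B) (p : ℕ) (t : W) (e : ZMod 2) :
    ((cs.signedConj i * cs.signedConj j) ^ p) (t, e) =
      ((cs.simple i * cs.simple j) ^ p * t * ((cs.simple i * cs.simple j) ^ p)⁻¹,
        e + ∑ r ∈ Finset.range (2 * p),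
          if t = cs.simple j * (cs.simple i * cs.simple j) ^ r then 1 else 0) := by
  induction p with
  | zero => simp; rfl
  | succ p ih =>
    have step : ((cs.signedConj i * cs.signedConj j) ^ (p + 1)) (t, e) =
        cs.signedConj i (cs.signedConj j (((cs.signedConj i * cs.signedConj j) ^ p) (t, e))) := by
      rw [pow_succ']; rfl
    rw [step, ih]
    set c := cs.simple i * cs.simple j with hc
    have hinv : c⁻¹ = cs.simple j * cs.simple i := by simp [hc]
    have hcj : ∀ k : ℕ, cs.simple j * c ^ k = (c ^ k)⁻¹ * cs.simple j := by
      intro k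
      have hconj : cs.simple j * c * (cs.simple j)⁻¹ = c⁻¹ := by simp [hc, mul_assoc]
      have := conj_pow (i := k) (a := cs.simple j) (b := c)
      rw [hconj, inv_pow] at this
      rw [this]; group
    have h1 : c ^ p * t * (c ^ p)⁻¹ = cs.simple j ↔ t = cs.simple j * c ^ (2 * p) := by
      rw [two_mul, pow_add, ← mul_assoc, hcj, mul_inv_eq_iff_eq_mul, mul_assoc,
        eq_inv_mul_iff_mul_eq]
    have h2 : cs.simple j * (c ^ p * t * (c ^ p)⁻¹) * cs.simple j = cs.simple i ↔
        t = cs.simple j * c ^ (2 * p + 1) := by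
      have e1 : cs.simple j * c ^ (2 * p + 1) =
          (c ^ p)⁻¹ * (cs.simple j * cs.simple i * cs.simple j) * c ^ p := by
        rw [show 2 * p + 1 = p + 1 + p by ring, pow_add, pow_succ, ← mul_assoc, ← mul_assoc, hcj,
          hc]
        simp only [mul_assoc]
      rw [e1]
      constructor
      · intro h
        rw [← h]
        simp [mul_assoc]
      · intro h
        rw [h]
        simp [mul_assoc]
    simp only [signedConj, h1, h2]
    rw [show 2 * (p + 1) = 2 * p + 1 + 1 by ring, Finset.sum_range_succ, Finset.sum_range_succ]
    refine Prod.ext ?_ ?_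
    · simp only [pow_succ' c p, mul_inv_rev, hinv]
      simp only [hc, mul_assoc]
    · simp only [add_assoc]

theorem isLiftable_signedConj : M.IsLiftable cs.signedConj := by
  classical
  intro i j
  funext ⟨t, e⟩
  rw [signedConj_mul_pow_apply]
  refine Prod.ext ?_ ?_
  · simp; rfl
  · rw [two_mul, Finset.sum_range_add]
    simp only [pow_add, simple_mul_simple_pow, one_mul]
    rw [CharTwo.add_self_eq_zero]
    exact add_zero e

open Classical in
theorem lift_signedConj_wordProd_apply (ω : List B) (t : W) (e : ZMod 2) :
    cs.lift ⟨cs.signedConj, cs.isLiftable_signedConj⟩ (cs.wordProd ω) (t, e) =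
      (cs.wordProd ω * t * (cs.wordProd ω)⁻¹, e + ((cs.rightInvSeq ω).count t : ZMod 2)) := by
  induction ω with
  | nil => simp; rfl
  | cons i ω ih =>
    have step : cs.lift ⟨cs.signedConj, cs.isLiftable_signedConj⟩ (cs.wordProd (i :: ω)) (t, e) =
        cs.signedConj i
          (cs.lift ⟨cs.signedConj, cs.isLiftable_signedConj⟩ (cs.wordProd ω) (t, e)) := by
      rw [wordProd_cons, map_mul, lift_apply_simple]; rfl
    rw [step, ih]
    have h : cs.wordProd ω * t * (cs.wordProd ω)⁻¹ = cs.simple i ↔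
        (cs.wordProd ω)⁻¹ * cs.simple i * cs.wordProd ω = t := by
      constructor <;> intro h <;> rw [← h] <;> simp [mul_assoc]
    refine Prod.ext ?_ ?_
    · simp [signedConj, wordProd_cons, mul_assoc]
    · simp [signedConj, rightInvSeq, h, List.count_cons, add_assoc]

open Classical in
/-- The parity of the number of occurrences of `t` in the left inversion sequence of a word
depends only on the product of the word. -/
theorem count_leftInvSeq_eq_of_wordProd_eq {ω ω' : List B}
    (h : cs.wordProd ω = cs.wordProd ω') (t : W) :
    ((cs.leftInvSeq ω).count t : ZMod 2) = (cs.leftInvSeq ω').count t := by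
  have h' : cs.wordProd ω.reverse = cs.wordProd ω'.reverse := by simp [h]
  have := cs.lift_signedConj_wordProd_apply ω.reverse t 0
  rw [h', lift_signedConj_wordProd_apply] at this
  simpa [rightInvSeq_reverse] using (congrArg Prod.snd this).symm

/-- The exchange condition. -/
theorem exists_eraseIdx_of_isLeftDescent {ω : List B} (i : B)
    (h : cs.IsLeftDescent (cs.wordProd ω) i) :
    ∃ k < ω.length, cs.simple i * cs.wordProd ω = cs.wordProd (ω.eraseIdx k) := by
  classical
  obtain ⟨σ, hσ, hσw⟩ := cs.exists_isReduced (cs.simple i * cs.wordProd ω)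
  have hprod : cs.wordProd ω = cs.wordProd (i :: σ) := by simp [wordProd_cons, ← hσw]
  have hred : cs.IsReduced (i :: σ) := by
    rw [isLeftDescent_iff] at h
    rw [IsReduced] at hσ ⊢
    rw [← hprod, List.length_cons, ← hσ, ← hσw, h]
  have hcount : (cs.leftInvSeq (i :: σ)).count (cs.simple i) = 1 :=
    List.count_eq_one_of_mem hred.nodup_leftInvSeq (by simp [leftInvSeq])
  have hmem : cs.simple i ∈ cs.leftInvSeq ω := by
    by_contra hn
    have := cs.count_leftInvSeq_eq_of_wordProd_eq hprod (cs.simple i)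
    rw [hcount, List.count_eq_zero_of_not_mem hn] at this
    simp at this
  obtain ⟨k, hk, hk'⟩ := List.getElem_of_mem hmem
  refine ⟨k, by simpa using hk, ?_⟩
  rw [← getD_leftInvSeq_mul_wordProd, List.getD_eq_getElem _ _ hk, hk']

/-- The elements `d` with `ℓ(td) > ℓ(d)` for all `t` in `L`. -/
def IsLeftReduced (L : Set B) (d : W) : Prop :=
  ∀ b ∈ L, cs.length d < cs.length (cs.simple b * d)

theorem mul_simple_eq_of_isLeftReduced {L : Set B} {d : W} (hd : cs.IsLeftReduced L d) (s : B) :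
    cs.IsLeftReduced L (d * cs.simple s) ∨ ∃ t ∈ L, d * cs.simple s = cs.simple t * d := by
  by_contra! hcon
  obtain ⟨hnr, hne⟩ := hcon
  simp only [IsLeftReduced, not_forall, not_lt] at hnr
  obtain ⟨t, htL, ht⟩ := hnr
  apply hne t htL
  obtain ⟨δ, hδ, rfl⟩ := cs.exists_isReduced d
  have htd := hd t htL
  have hdesc : cs.IsLeftDescent (cs.wordProd (δ ++ [s])) t := by
    rw [IsLeftDescent, wordProd_append, wordProd_singleton]
    exact lt_of_le_of_ne ht (cs.length_simple_mul_ne _ _)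
  obtain ⟨k, hk, hk'⟩ := cs.exists_eraseIdx_of_isLeftDescent t hdesc
  rw [wordProd_append, wordProd_singleton] at hk'
  rcases lt_or_ge k δ.length with hlt | hge
  · rw [List.eraseIdx_append_of_lt_length hlt, wordProd_append, wordProd_singleton,
      ← mul_assoc, mul_left_inj] at hk'
    have h1 := cs.length_wordProd_le (δ.eraseIdx k)
    rw [← hk', List.length_eraseIdx_of_lt hlt] at h1
    rw [IsReduced] at hδ
    omega
  · have : k = δ.length := by simp at hk; omega
    subst this
    rw [List.eraseIdx_append_of_length_le le_rfl] at hk'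
    simp only [Nat.sub_self, List.eraseIdx_cons_zero, List.append_nil] at hk'
    simpa using congrArg (cs.simple t * ·) hk'

theorem wordProd_mem_closure {L : Set B} {τ : List B} (h : ∀ b ∈ τ, b ∈ L) :
    cs.wordProd τ ∈ Subgroup.closure (cs.simple '' L) := by
  refine Subgroup.list_prod_mem _ fun x hx => ?_
  obtain ⟨b, hb, rfl⟩ := List.mem_map.1 hx
  exact Subgroup.subset_closure ⟨b, h b hb, rfl⟩

theorem exists_wordProd_eq_of_mem_closure {L : Set B} {a : W}
    (ha : a ∈ Subgroup.closure (cs.simple '' L)) :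
    ∃ τ : List B, (∀ b ∈ τ, b ∈ L) ∧ cs.wordProd τ = a := by
  induction ha using Subgroup.closure_induction with
  | mem x hx =>
    obtain ⟨b, hb, rfl⟩ := hx
    exact ⟨[b], by simpa using hb, by simp⟩
  | one => exact ⟨[], by simp, by simp⟩
  | mul x y _ _ hx hy =>
    obtain ⟨τ, h1, rfl⟩ := hx
    obtain ⟨σ, h2, rfl⟩ := hy
    refine ⟨τ ++ σ, ?_, cs.wordProd_append _ _⟩
    intro b hb
    exact (List.mem_append.1 hb).elim (h1 b) (h2 b)
  | inv x _ hx =>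
    obtain ⟨τ, h1, rfl⟩ := hx
    exact ⟨τ.reverse, by simpa using h1, by simp⟩

theorem isLeftReduced_of_length_le {L : Set B} {d : W}
    (hd : ∀ a ∈ Subgroup.closure (cs.simple '' L), cs.length d ≤ cs.length (a * d)) :
    cs.IsLeftReduced L d := fun b hb =>
  lt_of_le_of_ne (hd _ (Subgroup.subset_closure ⟨b, hb, rfl⟩)) (cs.length_simple_mul_ne d b).symm

theorem exists_minimal_coset_rep (L : Set B) (v : W) :
    ∃ a ∈ Subgroup.closure (cs.simple '' L),
      ∀ b ∈ Subgroup.closure (cs.simple '' L), cs.length (a * v) ≤ cs.length (b * (a * v)) := by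
  obtain ⟨a, ha⟩ := exists_minimalFor_of_wellFoundedLT
    (· ∈ Subgroup.closure (cs.simple '' L)) (fun a => cs.length (a * v)) ⟨1, one_mem _⟩
  refine ⟨a, ha.1, fun b hb => ?_⟩
  rw [← mul_assoc]
  by_contra hlt
  exact hlt (ha.2 (mul_mem hb ha.1) (not_le.1 hlt).le)

/-- An `L`-word which is shortest among the `L`-words with the same product, followed by a
reduced word of an element of minimal length in its `W_L`-coset, is reduced. -/
theorem length_wordProd_mul_of_minimal {L : Set B} {d : W}
    (hd : ∀ a ∈ Subgroup.closure (cs.simple '' L), cs.length d ≤ cs.length (a * d))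
    (τ : List B) (hτ : ∀ b ∈ τ, b ∈ L)
    (hmin : ∀ σ : List B, (∀ b ∈ σ, b ∈ L) → cs.wordProd σ = cs.wordProd τ →
      τ.length ≤ σ.length) :
    cs.length (cs.wordProd τ * d) = τ.length + cs.length d := by
  induction τ with
  | nil => simp
  | cons t τ ih =>
    have htL : t ∈ L := hτ t (by simp)
    have hτ' : ∀ b ∈ τ, b ∈ L := fun b hb => hτ b (by simp [hb])
    have ih' := ih hτ' fun σ hσ hσ' => by
      simpa using hmin (t :: σ) (by simpa [htL] using hσ) (by simp [wordProd_cons, hσ'])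
    obtain ⟨δ, hδ, hdδ⟩ := cs.exists_isReduced d
    rcases cs.length_simple_mul (cs.wordProd τ * d) t with h | h
    · rw [wordProd_cons, mul_assoc, h, ih', List.length_cons]; ring
    · exfalso
      have hdesc : cs.IsLeftDescent (cs.wordProd (τ ++ δ)) t := by
        rw [IsLeftDescent, wordProd_append, ← hdδ]; omega
      obtain ⟨k, hk, hk'⟩ := cs.exists_eraseIdx_of_isLeftDescent t hdesc
      rcases lt_or_ge k τ.length with hlt | hge
      · rw [List.eraseIdx_append_of_lt_length hlt, wordProd_append, wordProd_append,
          ← mul_assoc, mul_left_inj, ← wordProd_cons] at hk'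
        have := hmin (τ.eraseIdx k) (fun b hb => hτ' b (List.mem_of_mem_eraseIdx hb)) hk'.symm
        rw [List.length_eraseIdx_of_lt hlt, List.length_cons] at this
        omega
      · rw [List.eraseIdx_append_of_length_le hge, wordProd_append, wordProd_append, ← hdδ] at hk'
        have hlen : k - τ.length < δ.length := by
          rw [List.length_append] at hk; omega
        have hle := cs.length_wordProd_le (δ.eraseIdx (k - τ.length))
        rw [List.length_eraseIdx_of_lt hlen] at hle
        have hτW := cs.wordProd_mem_closure hτ'
        have htW := cs.wordProd_mem_closure hτ
        have := hd ((cs.wordProd τ)⁻¹ * cs.wordProd (t :: τ)) (mul_mem (inv_mem hτW) htW)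
        rw [wordProd_cons, mul_assoc, mul_assoc, hk', inv_mul_cancel_left] at this
        rw [IsReduced, ← hdδ] at hδ
        omega

theorem eq_of_isLeftReduced_of_minimal {L : Set B} {d b : W}
    (hd : ∀ a ∈ Subgroup.closure (cs.simple '' L), cs.length d ≤ cs.length (a * d))
    (hb : b ∈ Subgroup.closure (cs.simple '' L)) (hbd : cs.IsLeftReduced L (b * d)) :
    b = 1 := by
  obtain ⟨τ, ⟨hτL, hτb⟩, hmin⟩ := exists_minimalFor_of_wellFoundedLT
    (fun τ : List B => (∀ b ∈ τ, b ∈ L) ∧ cs.wordProd τ = b) List.length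
    (cs.exists_wordProd_eq_of_mem_closure hb)
  have hlen := cs.length_wordProd_mul_of_minimal hd τ hτL fun σ hσ hσ' => by
    by_contra hlt
    exact hlt (hmin ⟨hσ, hσ'.trans hτb⟩ (not_le.1 hlt).le)
  cases τ with
  | nil => simpa using hτb.symm
  | cons t τ =>
    exfalso
    have h1 := hbd t (hτL t (by simp))
    rw [← hτb, hlen, wordProd_cons, ← mul_assoc, simple_mul_simple_cancel_left,
      List.length_cons] at h1
    have h2 := cs.length_mul_le (cs.wordProd τ) d
    have h3 := cs.length_wordProd_le τ
    omega

/-- Left reduced elements of a coset of a standard parabolic subgroup are unique. -/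
theorem IsLeftReduced.eq_of_mul_eq_mul {L : Set B} {d d' a a' : W} (hd : cs.IsLeftReduced L d)
    (hd' : cs.IsLeftReduced L d') (ha : a ∈ Subgroup.closure (cs.simple '' L))
    (ha' : a' ∈ Subgroup.closure (cs.simple '' L)) (h : a * d = a' * d') : d = d' := by
  obtain ⟨c, hc, hmin⟩ := cs.exists_minimal_coset_rep L d
  have h1 := cs.eq_of_isLeftReduced_of_minimal hmin (inv_mem hc) (by simpa using hd)
  have hd'c : a'⁻¹ * a * c⁻¹ * (c * d) = d' := by
    rw [mul_assoc, inv_mul_cancel_left, mul_assoc, h, inv_mul_cancel_left]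
  have h2 := cs.eq_of_isLeftReduced_of_minimal hmin
    (mul_mem (mul_mem (inv_mem ha') ha) (inv_mem hc)) (by rwa [hd'c])
  rw [h1, mul_one] at h2
  rw [← hd'c, h1, h2, inv_eq_one.1 h1]
  simp

theorem exists_mul_wordProd_eq {L : Set B} (ω : List B) {d : W} (hd : cs.IsLeftReduced L d) :
    ∃ (τ : List B) (d' : W), (∀ b ∈ τ, b ∈ L) ∧ cs.IsLeftReduced L d' ∧
      d * cs.wordProd ω = cs.wordProd τ * d' ∧ τ.length ≤ ω.length ∧
      (ω.length ≤ τ.length → ∀ s ∈ ω, d * cs.simple s * d⁻¹ ∈ cs.simple '' L) := by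
  induction ω generalizing d with
  | nil => exact ⟨[], d, by simp, hd, by simp, le_rfl, by simp⟩
  | cons s ω ih =>
    rcases cs.mul_simple_eq_of_isLeftReduced hd s with h | ⟨t, htL, ht⟩
    · obtain ⟨τ, d', hτ, hd', hprod, hle, -⟩ := ih h
      refine ⟨τ, d', hτ, hd', ?_, hle.trans (by simp), fun hlen => ?_⟩
      · rw [wordProd_cons, ← mul_assoc, hprod]
      · rw [List.length_cons] at hlen; omega
    · obtain ⟨τ, d', hτ, hd', hprod, hle, hall⟩ := ih hd
      refine ⟨t :: τ, d', by simpa [htL] using hτ, hd', ?_, by simpa using hle, fun hlen => ?_⟩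
      · rw [wordProd_cons, ← mul_assoc, ht, mul_assoc, hprod, wordProd_cons, mul_assoc]
      · have hall' := hall (by simpa using hlen)
        intro b hb
        rcases List.mem_cons.1 hb with rfl | hb
        · exact ⟨t, htL, by rw [ht]; simp⟩
        · exact hall' b hb

/-- If `d w = a d` with `a ∈ W_L`, `d` left reduced and `ℓ(w) ≤ ℓ(a)`, then conjugation by `d`
sends the support of `w` into `L`. -/
theorem conj_mem_of_mem_coxSupport {L : Set B} {d w a : W} (hd : cs.IsLeftReduced L d)
    (ha : a ∈ Subgroup.closure (cs.simple '' L)) (h : d * w = a * d)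
    (hlen : cs.length w ≤ cs.length a) {s : B} (hs : s ∈ coxSupport cs w) :
    d * cs.simple s * d⁻¹ ∈ cs.simple '' L := by
  obtain ⟨ω, hω, rfl, hsω⟩ := hs
  obtain ⟨τ, d', hτ, hd', hprod, -, hall⟩ := cs.exists_mul_wordProd_eq ω hd
  have heq := h.symm.trans hprod
  obtain rfl := IsLeftReduced.eq_of_mul_eq_mul cs hd hd' ha (cs.wordProd_mem_closure hτ) heq
  refine hall ?_ s hsω
  rw [← hω.eq]
  exact hlen.trans (by rw [mul_right_cancel heq]; exact cs.length_wordProd_le τ)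

theorem mem_closure_coxSupport (w : W) :
    w ∈ Subgroup.closure (cs.simple '' coxSupport cs w) := by
  obtain ⟨ω, hω, hw⟩ := cs.exists_isReduced w
  have := cs.wordProd_mem_closure (L := coxSupport cs w) (τ := ω)
    fun b hb => ⟨ω, hω, hw.symm, hb⟩
  rwa [← hw] at this

theorem finite_image_coxSupport (w : W) : (cs.simple '' coxSupport cs w).Finite := by
  obtain ⟨ω, -, hw⟩ := cs.exists_isReduced w
  refine Set.Finite.subset (s := cs.simple '' {b | b ∈ ω}) (ω.finite_toSet.image _) ?_
  rintro _ ⟨s, hs, rfl⟩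
  have h1 : cs.IsLeftReduced {b | b ∈ ω} 1 := fun b _ => by simp
  have hw' := cs.wordProd_mem_closure (L := {b | b ∈ ω}) (τ := ω) fun b hb => hb
  rw [← hw] at hw'
  simpa using cs.conj_mem_of_mem_coxSupport h1 hw' (by simp) le_rfl hs

end CoxeterSystem

/-- If `w` has minimal length in its conjugacy class, `v ∈ W` satisfies
`ℓ(v⁻¹ w v) = ℓ(w)`, and `v = u · x` with `u ∈ W_{J(w)}`, `x ∈ X_{J(w)}` reduced,
then `J(v⁻¹ w v) = x⁻¹ J(w) x` (as sets of simple reflections). -/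
theorem stmt_6 {B W : Type*} [Group W] [Finite W] {M : CoxeterMatrix B}
    (cs : CoxeterSystem M W) (w : W)
    (hmin : ∀ v : W, cs.length w ≤ cs.length (v⁻¹ * w * v))
    (v u x : W)
    (hu : u ∈ Subgroup.closure (cs.simple '' coxSupport cs w))
    (hx : ∀ b ∈ coxSupport cs w, cs.length x < cs.length (cs.simple b * x))
    (hv : v = u * x)
    (hred : cs.length v = cs.length u + cs.length x)
    (hlen : cs.length (v⁻¹ * w * v) = cs.length w) :
    cs.simple '' coxSupport cs (v⁻¹ * w * v) =
      (fun g => x⁻¹ * g * x) '' (cs.simple '' coxSupport cs w) := by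
  set w' := v⁻¹ * w * v with hw'
  have hxK : (fun g => x * g * x⁻¹) '' (cs.simple '' coxSupport cs w') ⊆
      cs.simple '' coxSupport cs w := by
    rintro _ ⟨_, ⟨s, hs, rfl⟩, rfl⟩
    refine cs.conj_mem_of_mem_coxSupport (a := u⁻¹ * w * u) hx
      (mul_mem (mul_mem (inv_mem hu) (cs.mem_closure_coxSupport w)) hu) ?_ ?_ hs
    · simp [hw', hv, mul_assoc]
    · rw [hlen]; exact hmin u
  obtain ⟨c, hc, hcmin⟩ := cs.exists_minimal_coset_rep (coxSupport cs w') v⁻¹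
  have hcJ : (fun g => c * v⁻¹ * g * (c * v⁻¹)⁻¹) '' (cs.simple '' coxSupport cs w) ⊆
      cs.simple '' coxSupport cs w' := by
    rintro _ ⟨_, ⟨s, hs, rfl⟩, rfl⟩
    refine cs.conj_mem_of_mem_coxSupport (a := c * w' * c⁻¹)
      (cs.isLeftReduced_of_length_le hcmin)
      (mul_mem (mul_mem hc (cs.mem_closure_coxSupport w')) (inv_mem hc)) ?_ ?_ hs
    · simp [hw', mul_assoc]
    · have := hmin (v * c⁻¹)
      simpa [hw', mul_assoc] using this
  have hinj : ∀ y : W, Function.Injective fun g : W => y * g * y⁻¹ := fun y a b h => by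
    simpa using h
  have hcard : (cs.simple '' coxSupport cs w).ncard ≤
      ((fun g => x * g * x⁻¹) '' (cs.simple '' coxSupport cs w')).ncard := by
    rw [Set.ncard_image_of_injective _ (hinj x),
      ← Set.ncard_image_of_injective (cs.simple '' coxSupport cs w) (hinj (c * v⁻¹))]
    exact Set.ncard_le_ncard hcJ (cs.finite_image_coxSupport w')
  rw [← Set.eq_of_subset_of_ncard_le hxK hcard (cs.finite_image_coxSupport w), Set.image_image]
  simp [mul_assoc]
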